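/- Let k ≥ 1 and n ≥ 2k be positive integers. Let ℱ ⊆ ([n] choose k) and 𝒢 ⊆ ([n] choose k) be non-empty cross-intersecting families with |𝒢| ≥ |ℱ|. Then |ℱ| + |𝒢| ≤ C(n,k) − C(n−k,k) + 1. -/

import Mathlib

open Finset

section CrossIntersecting

variable {α : Type*} [DecidableEq α]

/-- Every member of `F` meets every member of `G`. -/
def CrossIntersecting (F G : Finset (Finset α)) : Prop :=
  ∀ A ∈ F, ∀ B ∈ G, (A ∩ B).Nonempty

lemma CrossIntersecting.symm {F G : Finset (Finset α)} (h : CrossIntersecting F G) :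
    CrossIntersecting G F := fun A hA B hB => by
  rw [inter_comm]; exact h B hB A hA

/-- `F` is closed under replacing `m` by any other element of `S`. -/
def ShiftStable (S : Finset α) (m : α) (F : Finset (Finset α)) : Prop :=
  ∀ A ∈ F, m ∈ A → ∀ x ∈ S, x ∉ A → insert x (A.erase m) ∈ F

lemma compress_singleton_of_mem {x m : α} {A : Finset α} (hxm : x ≠ m) (hm : m ∈ A)
    (hx : x ∉ A) : UV.compress {x} {m} A = insert x (A.erase m) := by
  rw [UV.compress, if_pos (by simp [hx, hm])]
  ext y
  simp only [sup_eq_union, mem_sdiff, mem_union, mem_singleton, mem_insert, mem_erase]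
  grind

lemma compress_singleton_of_not {x m : α} {A : Finset α} (h : ¬(m ∈ A ∧ x ∉ A)) :
    UV.compress {x} {m} A = A := by
  rw [UV.compress, if_neg]
  simpa [and_comm] using h

/-- Members of the compressed family are either old members whose shift is also a member,
or new shifts of old members. -/
lemma mem_shift {x m : α} (hxm : x ≠ m) {F : Finset (Finset α)} {B : Finset α}
    (h : B ∈ UV.compression {x} {m} F) :
    (B ∈ F ∧ (m ∈ B → x ∉ B → insert x (B.erase m) ∈ F)) ∨
      ∃ A ∈ F, m ∈ A ∧ x ∉ A ∧ B = insert x (A.erase m) := by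
  rw [UV.mem_compression] at h
  rcases h with ⟨h1, h2⟩ | ⟨h1, A, hA, rfl⟩
  · left
    refine ⟨h1, fun hm hx => ?_⟩
    rwa [compress_singleton_of_mem hxm hm hx] at h2
  · right
    by_cases hc : m ∈ A ∧ x ∉ A
    · exact ⟨A, hA, hc.1, hc.2, compress_singleton_of_mem hxm hc.1 hc.2⟩
    · rw [compress_singleton_of_not hc] at h1
      exact absurd hA h1

lemma shift_subset_powersetCard {x m : α} (hxm : x ≠ m) {S : Finset α} (hx : x ∈ S) {k : ℕ}
    {F : Finset (Finset α)} (hF : F ⊆ powersetCard k S) :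
    UV.compression {x} {m} F ⊆ powersetCard k S := by
  intro B hB
  rcases mem_shift hxm hB with ⟨h, -⟩ | ⟨A, hA, hm, hxA, rfl⟩
  · exact hF h
  · have := mem_powersetCard.1 (hF hA)
    rw [mem_powersetCard]
    refine ⟨insert_subset hx ((erase_subset _ _).trans this.1), ?_⟩
    rw [card_insert_of_notMem (by simp [hxA]), card_erase_add_one hm, this.2]

lemma CrossIntersecting.shift {x m : α} (hxm : x ≠ m) {F G : Finset (Finset α)}
    (h : CrossIntersecting F G) :
    CrossIntersecting (UV.compression {x} {m} F) (UV.compression {x} {m} G) := by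
  have key : ∀ {F G : Finset (Finset α)}, CrossIntersecting F G → ∀ A ∈ F, m ∈ A → x ∉ A →
      ∀ B ∈ G, (m ∈ B → x ∉ B → insert x (B.erase m) ∈ G) →
      (insert x (A.erase m) ∩ B).Nonempty := by
    intro F G h A hA hm hx B hB hB'
    by_cases hxB : x ∈ B
    · exact ⟨x, by simp [hxB]⟩
    by_cases hmB : m ∈ B
    · obtain ⟨y, hy⟩ := h A hA _ (hB' hmB hxB)
      refine ⟨y, ?_⟩
      simp only [mem_inter, mem_insert, mem_erase] at hy ⊢
      grind
    · obtain ⟨y, hy⟩ := h A hA B hB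
      refine ⟨y, ?_⟩
      simp only [mem_inter, mem_insert, mem_erase] at hy ⊢
      grind
  intro A hA B hB
  rcases mem_shift hxm hA with ⟨hA1, hA2⟩ | ⟨A, hA1, hmA, hxA, rfl⟩ <;>
  rcases mem_shift hxm hB with ⟨hB1, hB2⟩ | ⟨B, hB1, hmB, hxB, rfl⟩
  · exact h A hA1 B hB1
  · rw [inter_comm]
    exact key h.symm B hB1 hmB hxB A hA1 hA2
  · exact key h A hA1 hmA hxA B hB1 hB2
  · exact ⟨x, by simp⟩

lemma filter_mem_shift_subset {x m : α} (hxm : x ≠ m) (F : Finset (Finset α)) :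
    (UV.compression {x} {m} F).filter (m ∈ ·) ⊆ F.filter (m ∈ ·) := by
  intro B hB
  rw [mem_filter] at hB ⊢
  rcases mem_shift hxm hB.1 with ⟨h, -⟩ | ⟨A, hA, hm, hxA, rfl⟩
  · exact ⟨h, hB.2⟩
  · have := hB.2
    simp [hxm.symm] at this

lemma filter_mem_shift_ssubset {x m : α} (hxm : x ≠ m) {F : Finset (Finset α)} {A : Finset α}
    (hA : A ∈ F) (hm : m ∈ A) (hx : x ∉ A) (hAx : insert x (A.erase m) ∉ F) :
    (UV.compression {x} {m} F).filter (m ∈ ·) ⊂ F.filter (m ∈ ·) := by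
  refine (ssubset_iff_of_subset (filter_mem_shift_subset hxm F)).2 ⟨A, by simp [hA, hm], ?_⟩
  intro h
  rcases mem_shift hxm (mem_filter.1 h).1 with ⟨-, h⟩ | ⟨B, -, -, -, rfl⟩
  · exact hAx (h hm hx)
  · simp at hx

/-- Shifting reduces cross-intersecting pairs to shift-stable ones of the same sizes. -/
lemma exists_shiftStable (S : Finset α) (m : α) (k : ℕ) :
    ∀ (N : ℕ) (F G : Finset (Finset α)), #(F.filter (m ∈ ·)) + #(G.filter (m ∈ ·)) = N →
      F ⊆ powersetCard k S → G ⊆ powersetCard k S → CrossIntersecting F G →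
      ∃ F' G' : Finset (Finset α), #F' = #F ∧ #G' = #G ∧ F' ⊆ powersetCard k S ∧
        G' ⊆ powersetCard k S ∧ CrossIntersecting F' G' ∧
        ShiftStable S m F' ∧ ShiftStable S m G' := by
  intro N
  induction N using Nat.strong_induction_on with
  | _ N ih =>
    intro F G hN hF hG h
    have step : ∀ x ∈ S, x ≠ m →
        #((UV.compression {x} {m} F).filter (m ∈ ·)) +
          #((UV.compression {x} {m} G).filter (m ∈ ·)) < N →
        ∃ F' G' : Finset (Finset α), #F' = #F ∧ #G' = #G ∧ F' ⊆ powersetCard k S ∧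
          G' ⊆ powersetCard k S ∧ CrossIntersecting F' G' ∧
          ShiftStable S m F' ∧ ShiftStable S m G' := by
      intro x hx hxm hlt
      obtain ⟨F', G', h1, h2, h3⟩ := ih _ hlt _ _ rfl (shift_subset_powersetCard hxm hx hF)
        (shift_subset_powersetCard hxm hx hG) (h.shift hxm)
      rw [UV.card_compression] at h1 h2
      exact ⟨F', G', h1, h2, h3⟩
    by_cases hsF : ShiftStable S m F
    · by_cases hsG : ShiftStable S m G
      · exact ⟨F, G, rfl, rfl, hF, hG, h, hsF, hsG⟩
      · simp only [ShiftStable, not_forall] at hsG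
        obtain ⟨A, hA, hm, x, hx, hxA, hn⟩ := hsG
        have hxm : x ≠ m := fun e => hxA (e ▸ hm)
        have h1 := card_le_card (filter_mem_shift_subset hxm F)
        have h2 := card_lt_card (filter_mem_shift_ssubset hxm hA hm hxA hn)
        exact step x hx hxm (by omega)
    · simp only [ShiftStable, not_forall] at hsF
      obtain ⟨A, hA, hm, x, hx, hxA, hn⟩ := hsF
      have hxm : x ≠ m := fun e => hxA (e ▸ hm)
      have h1 := card_le_card (filter_mem_shift_subset hxm G)
      have h2 := card_lt_card (filter_mem_shift_ssubset hxm hA hm hxA hn)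
      exact step x hx hxm (by omega)

/-- A family of `j`-subsets of `T` all meeting a fixed `k`-subset of `T`. -/
lemma card_add_choose_le_of_forall_inter {T A : Finset α} {k j : ℕ} (hA : A ∈ powersetCard k T)
    {Q : Finset (Finset α)} (hQ : Q ⊆ powersetCard j T) (h : ∀ B ∈ Q, (A ∩ B).Nonempty) :
    #Q + (#T - k).choose j ≤ (#T).choose j := by
  rw [mem_powersetCard] at hA
  have hd : Disjoint Q (powersetCard j (T \ A)) := by
    rw [disjoint_left]
    intro B hB hB'
    obtain ⟨y, hy⟩ := h B hB
    rw [mem_inter] at hy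
    exact (mem_sdiff.1 ((mem_powersetCard.1 hB').1 hy.2)).2 hy.1
  have := card_le_card (union_subset hQ
    (powersetCard_mono (n := j) (sdiff_subset (s := T) (t := A))))
  rwa [card_union_of_disjoint hd, card_powersetCard, card_powersetCard,
    card_sdiff_of_subset hA.1, hA.2] at this

lemma card_add_card_le_of_card_eq {S : Finset α} {k : ℕ} (hS : #S = 2 * k)
    {F G : Finset (Finset α)} (hF : F ⊆ powersetCard k S) (hG : G ⊆ powersetCard k S)
    (h : CrossIntersecting F G) : #F + #G ≤ (#S).choose k := by
  have hinj : Set.InjOn (fun B => S \ B) (G : Set (Finset α)) := by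
    intro B hB C hC hBC
    have hB := (mem_powersetCard.1 (hG hB)).1
    have hC := (mem_powersetCard.1 (hG hC)).1
    rw [← Finset.sdiff_sdiff_eq_self hB, ← Finset.sdiff_sdiff_eq_self hC]
    exact congrArg (S \ ·) hBC
  rw [← card_image_of_injOn hinj, ← card_powersetCard, ← card_union_of_disjoint]
  · refine card_le_card (union_subset hF ?_)
    intro C hC
    obtain ⟨B, hB, rfl⟩ := mem_image.1 hC
    have hB := mem_powersetCard.1 (hG hB)
    rw [mem_powersetCard, card_sdiff_of_subset hB.1]
    exact ⟨sdiff_subset, by omega⟩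
  · rw [disjoint_left]
    intro C hC hC'
    obtain ⟨B, hB, rfl⟩ := mem_image.1 hC'
    obtain ⟨y, hy⟩ := h _ hC B hB
    simp at hy

lemma ShiftStable.nonMemberSubfamily_nonempty {T : Finset α} {m : α} {k : ℕ} (hk : k ≤ #T)
    {F : Finset (Finset α)} (hF : F ⊆ powersetCard k (insert m T)) (hm : m ∉ T)
    (hs : ShiftStable (insert m T) m F) (hne : F.Nonempty) :
    (F.nonMemberSubfamily m).Nonempty := by
  obtain ⟨A, hA⟩ := hne
  by_cases hmA : m ∈ A
  · have hA' := mem_powersetCard.1 (hF hA)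
    obtain ⟨x, hx, hxA⟩ : ∃ x ∈ insert m T, x ∉ A := by
      apply exists_mem_notMem_of_card_lt_card
      rw [card_insert_of_notMem hm]
      omega
    refine ⟨_, mem_nonMemberSubfamily.2 ⟨hs A hA hmA x hx hxA, ?_⟩⟩
    have : m ≠ x := fun e => hxA (e ▸ hmA)
    simp [this]
  · exact ⟨A, mem_nonMemberSubfamily.2 ⟨hA, hmA⟩⟩

lemma nonMemberSubfamily_subset_powersetCard {T : Finset α} {m : α} {k : ℕ}
    {F : Finset (Finset α)} (hF : F ⊆ powersetCard k (insert m T)) :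
    F.nonMemberSubfamily m ⊆ powersetCard k T := by
  intro A hA
  rw [mem_nonMemberSubfamily] at hA
  have h := mem_powersetCard.1 (hF hA.1)
  exact mem_powersetCard.2 ⟨(subset_insert_iff_of_notMem hA.2).1 h.1, h.2⟩

lemma memberSubfamily_subset_powersetCard {T : Finset α} {m : α} {j : ℕ}
    {F : Finset (Finset α)} (hF : F ⊆ powersetCard (j + 1) (insert m T)) :
    F.memberSubfamily m ⊆ powersetCard j T := by
  intro A hA
  rw [mem_memberSubfamily] at hA
  have h := mem_powersetCard.1 (hF hA.1)
  rw [card_insert_of_notMem hA.2] at h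
  exact mem_powersetCard.2 ⟨(insert_subset_insert_iff hA.2).1 h.1, by omega⟩

lemma CrossIntersecting.nonMember_nonMember {F G : Finset (Finset α)} (h : CrossIntersecting F G)
    (m : α) : CrossIntersecting (F.nonMemberSubfamily m) (G.nonMemberSubfamily m) :=
  fun A hA B hB => h A (mem_nonMemberSubfamily.1 hA).1 B (mem_nonMemberSubfamily.1 hB).1

lemma CrossIntersecting.nonMember_member {F G : Finset (Finset α)} (h : CrossIntersecting F G)
    (m : α) : CrossIntersecting (F.nonMemberSubfamily m) (G.memberSubfamily m) := by
  intro A hA B hB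
  rw [mem_nonMemberSubfamily] at hA
  have := h A hA.1 _ (mem_memberSubfamily.1 hB).1
  rwa [inter_insert_of_notMem hA.2] at this

lemma CrossIntersecting.member_member {T : Finset α} {m : α} {j : ℕ} (hj : 2 * (j + 1) ≤ #T)
    {F G : Finset (Finset α)} (hF : F ⊆ powersetCard (j + 1) (insert m T))
    (hG : G ⊆ powersetCard (j + 1) (insert m T)) (hs : ShiftStable (insert m T) m F)
    (h : CrossIntersecting F G) :
    CrossIntersecting (F.memberSubfamily m) (G.memberSubfamily m) := by
  intro A hA B hB
  have hA1 := mem_powersetCard.1 (memberSubfamily_subset_powersetCard hF hA)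
  have hB1 := mem_powersetCard.1 (memberSubfamily_subset_powersetCard hG hB)
  rw [mem_memberSubfamily] at hA hB
  obtain ⟨x, hx, hxAB⟩ : ∃ x ∈ T, x ∉ insert m (A ∪ B) := by
    apply exists_mem_notMem_of_card_lt_card
    have := card_insert_le m (A ∪ B)
    have := card_union_le A B
    omega
  simp only [mem_insert, mem_union, not_or] at hxAB
  have hA2 := hs _ hA.1 (mem_insert_self _ _) x (mem_insert_of_mem hx) (by simp [hxAB])
  obtain ⟨y, hy⟩ := h _ hA2 _ hB.1
  refine ⟨y, ?_⟩
  simp only [mem_inter, mem_insert, mem_erase] at hy ⊢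
  grind

/-- Hilton–Milner bound for non-empty cross-intersecting families over an arbitrary ground set. -/
theorem CrossIntersecting.card_add_card_add_choose_le (S : Finset α) :
    ∀ (k : ℕ) (F G : Finset (Finset α)), 2 * k ≤ #S → F ⊆ powersetCard k S →
      G ⊆ powersetCard k S → F.Nonempty → G.Nonempty → CrossIntersecting F G →
      #F + #G + (#S - k).choose k ≤ (#S).choose k + 1 := by
  induction S using Finset.induction_on with
  | empty =>
    intro k F G hk hF hG _ _ h
    have hk0 : k = 0 := by simpa using hk
    subst hk0
    simpa using card_add_card_le_of_card_eq (by simp) hF hG h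
  | insert m T hm ih =>
    intro k F G hk hF hG hFne hGne h
    rcases hk.eq_or_lt with hk | hk
    · have := card_add_card_le_of_card_eq hk.symm hF hG h
      have e : #(insert m T) - k = k := by omega
      rw [e, Nat.choose_self]
      omega
    rw [card_insert_of_notMem hm] at hk ⊢
    obtain ⟨F', G', hFc, hGc, hF', hG', h', hsF, hsG⟩ := exists_shiftStable _ m k _ F G rfl hF hG h
    rw [← hFc, ← hGc]
    have hFne' : F'.Nonempty := by rw [← card_pos, hFc]; exact card_pos.2 hFne
    have hGne' : G'.Nonempty := by rw [← card_pos, hGc]; exact card_pos.2 hGne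
    clear hFc hGc hF hG h hFne hGne F G
    have hF0 := nonMemberSubfamily_subset_powersetCard hF'
    have hG0 := nonMemberSubfamily_subset_powersetCard hG'
    have hF0ne := hsF.nonMemberSubfamily_nonempty (by omega) hF' hm hFne'
    have hG0ne := hsG.nonMemberSubfamily_nonempty (by omega) hG' hm hGne'
    have ih0 := ih k _ _ (by omega) hF0 hG0 hF0ne hG0ne (h'.nonMember_nonMember m)
    rw [← card_memberSubfamily_add_card_nonMemberSubfamily m F',
      ← card_memberSubfamily_add_card_nonMemberSubfamily m G']
    obtain _ | j := k
    · obtain ⟨A, hA⟩ := hFne'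
      obtain ⟨B, hB⟩ := hGne'
      have hA1 := mem_powersetCard.1 (hF' hA)
      have := h' A hA B hB
      simp [card_eq_zero.1 hA1.2] at this
    have hF1 := memberSubfamily_subset_powersetCard hF'
    have hG1 := memberSubfamily_subset_powersetCard hG'
    have e1 : #T + 1 - (j + 1) = (#T - (j + 1)) + 1 := by omega
    rw [e1, Nat.choose_succ_succ', Nat.choose_succ_succ']
    rcases (F'.memberSubfamily m).eq_empty_or_nonempty with hFe | hF1ne
    · obtain ⟨A, hA⟩ := hF0ne
      have := card_add_choose_le_of_forall_inter (hF0 hA) hG1 (h'.nonMember_member m A hA)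
      rw [hFe, card_empty]
      omega
    rcases (G'.memberSubfamily m).eq_empty_or_nonempty with hGe | hG1ne
    · obtain ⟨A, hA⟩ := hG0ne
      have := card_add_choose_le_of_forall_inter (hG0 hA) hF1 (h'.symm.nonMember_member m A hA)
      rw [hGe, card_empty]
      omega
    have h1 := h'.member_member (by omega) hF' hG' hsF
    have ih1 := ih j _ _ (by omega) hF1 hG1 hF1ne hG1ne h1
    have e2 : #T - j = (#T - (j + 1)) + 1 := by omega
    obtain _ | i := j
    · obtain ⟨A, hA⟩ := hF1ne
      obtain ⟨B, hB⟩ := hG1ne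
      have hA1 := mem_powersetCard.1 (hF1 hA)
      have := h1 A hA B hB
      simp [card_eq_zero.1 hA1.2] at this
    rw [e2, Nat.choose_succ_succ'] at ih1
    have : 0 < (#T - (i + 1 + 1)).choose i := Nat.choose_pos (by omega)
    omega

end CrossIntersecting

/-- Hilton–Milner (cross-intersecting form, bound only): if `ℱ, 𝒢 ⊆ ([n] choose k)`
are non-empty cross-intersecting families with `|𝒢| ≥ |ℱ|`, then
`|ℱ| + |𝒢| ≤ C(n,k) − C(n−k,k) + 1`. -/
theorem stmt_3 (k n : ℕ) (hk : 1 ≤ k) (hn : 2 * k ≤ n)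
    (F G : Finset (Finset ℕ))
    (hF : F ⊆ powersetCard k (Icc 1 n))
    (hG : G ⊆ powersetCard k (Icc 1 n))
    (hFne : F.Nonempty) (hGne : G.Nonempty)
    (hcross : ∀ A ∈ F, ∀ B ∈ G, (A ∩ B).Nonempty)
    (hcard : F.card ≤ G.card) :
    (F.card : ℤ) + G.card ≤ (n.choose k : ℤ) - (n - k).choose k + 1 := by
  have := CrossIntersecting.card_add_card_add_choose_le (Icc 1 n) k F G (by simpa using hn)
    hF hG hFne hGne hcross
  rw [Nat.card_Icc, Nat.add_sub_cancel] at this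
  omega
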